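/- Let H be a nonzero finite-dimensional complex inner product space, let c be a complex number, and let L : ℤ → End(H) be a family of linear operators satisfying the Virasoro relations with central charge c, namely L_m ∘ L_n − L_n ∘ L_m = (m − n)·L_{m+n} + (c/12)·(m³ − m)·δ_{m,−n}·id for all integers m, n, together with the unitarity condition (L_n)* = L_{−n} for all n (adjoint with respect to the inner product). Then L_n = 0 for every integer n and c = 0. (This is the infinitesimal content of the paper's lemma that every projective unitary finite-dimensional representation of Diff(S¹) is trivial.) -/

import Mathlib

/-- The trace of `A* A` is the squared Hilbert–Schmidt norm of `A`. -/
theorem LinearMap.trace_adjoint_comp_self_eq_sum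
    {H : Type*} [NormedAddCommGroup H] [InnerProductSpace ℂ H] [FiniteDimensional ℂ H]
    {ι : Type*} [Fintype ι] (b : OrthonormalBasis ι ℂ H) (A : H →ₗ[ℂ] H) :
    LinearMap.trace ℂ H (LinearMap.adjoint A ∘ₗ A) = ((∑ i, ‖A (b i)‖ ^ 2 : ℝ) : ℂ) := by
  rw [LinearMap.trace_eq_sum_inner _ b]
  push_cast
  refine Finset.sum_congr rfl fun i _ => ?_
  rw [Function.comp_apply, LinearMap.adjoint_inner_right, inner_self_eq_norm_sq_to_K]
  rfl

/-- If `tr (A* A) + 2 tr (B* B) = 0`, then `A` and `B` both vanish. -/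
theorem LinearMap.eq_zero_and_eq_zero_of_trace_adjoint_comp_self_add
    {H : Type*} [NormedAddCommGroup H] [InnerProductSpace ℂ H] [FiniteDimensional ℂ H]
    {A B : H →ₗ[ℂ] H}
    (h : LinearMap.trace ℂ H (LinearMap.adjoint A ∘ₗ A) +
      2 * LinearMap.trace ℂ H (LinearMap.adjoint B ∘ₗ B) = 0) :
    A = 0 ∧ B = 0 := by
  let b := stdOrthonormalBasis ℂ H
  have eq_zero (T : H →ₗ[ℂ] H) (hT : ∑ i, ‖T (b i)‖ ^ 2 = 0) : T = 0 := by
    refine b.toBasis.ext fun i => ?_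
    have := (Finset.sum_eq_zero_iff_of_nonneg fun i _ => sq_nonneg ‖T (b i)‖).1 hT i
      (Finset.mem_univ i)
    simpa using this
  rw [trace_adjoint_comp_self_eq_sum b, trace_adjoint_comp_self_eq_sum b] at h
  have hreal : ∑ i, ‖A (b i)‖ ^ 2 + 2 * ∑ i, ‖B (b i)‖ ^ 2 = 0 := by exact_mod_cast h
  have hA : 0 ≤ ∑ i, ‖A (b i)‖ ^ 2 := by positivity
  have hB : 0 ≤ ∑ i, ‖B (b i)‖ ^ 2 := by positivity
  exact ⟨eq_zero A (by linarith), eq_zero B (by linarith)⟩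

/-- Every unitary family of operators on a nonzero finite-dimensional complex inner
product space satisfying the Virasoro relations with central charge `c` is trivial:
all `L n` vanish and `c = 0`. -/
theorem virasoro_finite_dim_unitary_trivial
    {H : Type*} [NormedAddCommGroup H] [InnerProductSpace ℂ H]
    [FiniteDimensional ℂ H] [Nontrivial H]
    (c : ℂ) (L : ℤ → H →ₗ[ℂ] H)
    (hrel : ∀ m n : ℤ, L m ∘ₗ L n - L n ∘ₗ L m =
      ((m : ℂ) - (n : ℂ)) • L (m + n) +
        ((c / 12) * ((m : ℂ) ^ 3 - (m : ℂ)) * (if n = -m then 1 else 0)) •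
          (LinearMap.id : H →ₗ[ℂ] H))
    (hadj : ∀ n : ℤ, LinearMap.adjoint (L n) = L (-n)) :
    (∀ n : ℤ, L n = 0) ∧ c = 0 := by
  have trace_comp_comm (A B : H →ₗ[ℂ] H) :
      LinearMap.trace ℂ H (A ∘ₗ B) = LinearMap.trace ℂ H (B ∘ₗ A) :=
    LinearMap.trace_mul_comm ℂ A B
  have hdim : (Module.finrank ℂ H : ℂ) ≠ 0 := by
    exact_mod_cast (Module.finrank_pos (R := ℂ) (M := H)).ne'
  have htrace (n : ℤ) : 2 * n * LinearMap.trace ℂ H (L 0) +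
      c / 12 * ((n : ℂ) ^ 3 - n) * Module.finrank ℂ H = 0 := by
    have h := congrArg (LinearMap.trace ℂ H) (hrel n (-n))
    rw [map_sub, trace_comp_comm, sub_self] at h
    simp at h
    linear_combination -h
  have hc : c = 0 := by
    have h1 := htrace 1
    have h2 := htrace 2
    push_cast at h1 h2
    have : c * Module.finrank ℂ H = 0 := by linear_combination 2 * h2 - 4 * h1
    exact (mul_eq_zero.1 this).resolve_right hdim
  subst hc
  -- Invariance of the trace form gives `tr (L₋ₙ Lₙ) = -2 tr (L₀²)`; both traces are nonnegative.
  have hvanish (n : ℤ) (hn : n ≠ 0) : L n = 0 ∧ L 0 = 0 := by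
    apply LinearMap.eq_zero_and_eq_zero_of_trace_adjoint_comp_self_add
    rw [hadj, hadj, neg_zero]
    have hbracket := congrArg (fun T => LinearMap.trace ℂ H (L 0 ∘ₗ T)) (hrel n (-n))
    have hweight := congrArg (fun T => LinearMap.trace ℂ H (T ∘ₗ L (-n))) (hrel 0 n)
    simp [LinearMap.comp_sub, LinearMap.sub_comp, LinearMap.comp_smul, LinearMap.smul_comp]
      at hbracket hweight
    have hcyc : LinearMap.trace ℂ H (L 0 ∘ₗ L (-n) ∘ₗ L n) =
        LinearMap.trace ℂ H ((L n ∘ₗ L 0) ∘ₗ L (-n)) := by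
      rw [← LinearMap.comp_assoc, trace_comp_comm, LinearMap.comp_assoc]
    rw [hcyc] at hbracket
    rw [trace_comp_comm (L n)] at hweight
    rw [LinearMap.comp_assoc] at hweight
    have hn' : (n : ℂ) ≠ 0 := by exact_mod_cast hn
    apply mul_left_cancel₀ hn'
    linear_combination hweight - hbracket
  refine ⟨fun n => ?_, rfl⟩
  rcases eq_or_ne n 0 with rfl | hn
  · exact (hvanish 1 one_ne_zero).2
  · exact (hvanish n hn).1
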